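/- arXiv:1704.06314 — 2 statements merged into one kernel-verified Lean document; each statement's English description precedes it below -/
import Mathlib

section
/- For every γ > 0 there is n₀ ∈ ℕ such that for all n ≥ n₀ and all reals ε with 2^{−(2α−1)n/2} ≤ ε ≤ 1/6: if f is drawn from the distribution D_no, then the probability that f is ε-far from every k-junta (with k = ⌊αn⌋) is at least 1 − γ. -/
open Finset

/-- `f : {0,1}^n → {0,1}` is a `k`-junta: there is a set `S ⊆ [n]` with `|S| ≤ k`
such that `f x = f y` whenever `x` and `y` agree on all coordinates in `S`. -/
def IsJunta (n k : ℕ) (f : (Fin n → Bool) → Bool) : Prop :=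
  ∃ S : Finset (Fin n), S.card ≤ k ∧
    ∀ x y : Fin n → Bool, (∀ i ∈ S, x i = y i) → f x = f y

/-- `f` is `ε`-far from every `k`-junta. -/
def FarFromJuntas (n k : ℕ) (ε : ℝ) (f : (Fin n → Bool) → Bool) : Prop :=
  ∀ g : (Fin n → Bool) → Bool, IsJunta n k g →
    ε * 2 ^ n ≤ ((Finset.univ.filter (fun x => f x ≠ g x)).card : ℝ)

/-- Probability of obtaining exactly the subset `A` when each element of `U` is included
independently with probability `ρ` (and elements outside `U` are never included). -/
noncomputable def pSet {ι : Type*} [DecidableEq ι] (U : Finset ι) (ρ : ℝ) (A : Finset ι) : ℝ :=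
  if A ⊆ U then ρ ^ A.card * (1 - ρ) ^ (U.card - A.card) else 0

/-- Zero out the coordinates outside `M`.  Two strings have the same `padTo M` iff they
agree on all coordinates of `M`, so `padTo M x` serves as the index `Γ_M(x)`:
it identifies the restriction `x|_M`. -/
def padTo {n : ℕ} (M : Finset (Fin n)) (x : Fin n → Bool) : Fin n → Bool :=
  fun j => if j ∈ M then x j else false

/-- The function `f = f_{M,S,H}` built from the addressing set `M`, the family of subsets
`S_i ⊆ A` and the family of random functions `h_i(x) = z_i(x|_{S_i})`: on input `x`, the
index `i = Γ_M(x)` (represented by `padTo M x`) selects `S_i` and `z_i`, and the value is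
`z_i` evaluated at the restriction of `x` to `S_i` (represented by `padTo (S i) x`). -/
def buildF {n : ℕ} (M : Finset (Fin n)) (S : (Fin n → Bool) → Finset (Fin n))
    (z : (Fin n → Bool) → (Fin n → Bool) → Bool) : (Fin n → Bool) → Bool :=
  fun x => z (padTo M x) (padTo (S (padTo M x)) x)

open Classical in
/-- The probability, for fixed `M` and `A`, that the random function `f` obtained by
sampling each `S_i ⊆ A` (elements included independently with probability `ρ`) and
each `h_i` a uniformly random function of the coordinates in `S_i`, satisfies `E f`. -/
noncomputable def prSH (n : ℕ) (M A : Finset (Fin n)) (ρ : ℝ)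
    (E : ((Fin n → Bool) → Bool) → Prop) : ℝ :=
  ∑ S : (Fin n → Bool) → Finset (Fin n),
    ∑ z : (Fin n → Bool) → (Fin n → Bool) → Bool,
      (if E (buildF M S z) then 1 else 0) * (∏ y : Fin n → Bool, pSet A ρ (S y)) /
        (Fintype.card ((Fin n → Bool) → (Fin n → Bool) → Bool) : ℝ)

/-- The probability that a random function `f` drawn from the distribution `D` (with
`M` a uniformly random subset of `[n]` of size `t`, `A ⊆ [n]∖M` with each element
included independently with probability `ρA`, each `S_i ⊆ A` with rate `ρS`, and each
`h_i` a uniformly random function of the coordinates in `S_i`) satisfies `E f`.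
Taking `ρA = 1/2` gives `D_yes`; taking `ρA = 1/2 + (log₂ n)/√n` gives `D_no`. -/
noncomputable def prD (n t : ℕ) (ρA ρS : ℝ)
    (E : ((Fin n → Bool) → Bool) → Prop) : ℝ :=
  (∑ M ∈ Finset.univ.filter (fun M : Finset (Fin n) => M.card = t),
    ∑ A : Finset (Fin n), pSet Mᶜ ρA A * prSH n M A ρS E) / (n.choose t : ℝ)

section helpers

lemma sum_pSet_pow {ι : Type*} [DecidableEq ι] [Fintype ι] (U : Finset ι) (ρ c : ℝ) :
    ∑ A : Finset ι, pSet U ρ A * c ^ A.card = (ρ * c + (1 - ρ)) ^ U.card := by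
  rw [← Finset.sum_pow_mul_eq_add_pow]
  rw [← Finset.sum_subset (Finset.subset_univ U.powerset)]
  · refine Finset.sum_congr rfl fun A hA => ?_
    rw [Finset.mem_powerset] at hA
    simp only [pSet, hA, if_true, mul_pow]; ring
  · intro A _ hA
    rw [Finset.mem_powerset] at hA
    simp [pSet, hA]

lemma sum_pSet {ι : Type*} [DecidableEq ι] [Fintype ι] (U : Finset ι) (ρ : ℝ) :
    ∑ A : Finset ι, pSet U ρ A = 1 := by
  have := sum_pSet_pow U ρ 1
  simpa using this

lemma pSet_nonneg {ι : Type*} [DecidableEq ι] (U : Finset ι) (ρ : ℝ) (h0 : 0 ≤ ρ) (h1 : ρ ≤ 1)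
    (A : Finset ι) : 0 ≤ pSet U ρ A := by
  unfold pSet
  split_ifs
  · exact mul_nonneg (pow_nonneg h0 _) (pow_nonneg (by linarith) _)
  · exact le_rfl

/-- probability of missing `U` entirely -/
lemma sum_pSet_disj {ι : Type*} [DecidableEq ι] [Fintype ι] (A U : Finset ι) (hU : U ⊆ A)
    (ρ : ℝ) :
    ∑ T : Finset ι, (if (T ∩ U).Nonempty then (1 : ℝ) else 0) * pSet A ρ T
      = 1 - (1 - ρ) ^ U.card := by
  have h1 : ∀ T : Finset ι, (if (T ∩ U).Nonempty then (1 : ℝ) else 0) * pSet A ρ T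
      = pSet A ρ T - (1 - ρ) ^ U.card * pSet (A \ U) ρ T := by
    intro T
    by_cases h : (T ∩ U).Nonempty
    · have : ¬ T ⊆ A \ U := by
        intro hT
        obtain ⟨i, hi⟩ := h
        rw [Finset.mem_inter] at hi
        have := hT hi.1
        simp [hi.2] at this
      simp [h, pSet, this]
    · have hd : ∀ i ∈ T, i ∉ U := by
        intro i hi hiU
        exact h ⟨i, by simp [hi, hiU]⟩
      simp only [h, if_false, zero_mul, pSet]
      by_cases hT : T ⊆ A
      · have hT' : T ⊆ A \ U := by
          intro i hi
          simp [hT hi, hd i hi]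
        have hc : (A \ U).card = A.card - U.card := Finset.card_sdiff_of_subset hU
        have h3 := Finset.card_le_card hT'
        have h4 := Finset.card_le_card hU
        simp only [hT, hT', if_true]
        have : A.card - T.card = U.card + ((A \ U).card - T.card) := by omega
        rw [this, pow_add]; ring
      · have hT' : ¬ T ⊆ A \ U := fun h' => hT (h'.trans Finset.sdiff_subset)
        simp [hT, hT']
  rw [Finset.sum_congr rfl (fun T _ => h1 T), Finset.sum_sub_distrib, ← Finset.mul_sum,
    sum_pSet, sum_pSet, mul_one]

lemma exp_neg_le (x : ℝ) (hx : 0 ≤ x) : Real.exp (-x) ≤ 1 - x + x ^ 2 / 2 := by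
  have h := Real.quadratic_le_exp_of_nonneg hx
  have h1 : Real.exp (-x) * Real.exp x = 1 := by rw [← Real.exp_add]; simp
  have h2 := Real.exp_pos (-x)
  have h3 : Real.exp (-x) * (1 + x + x ^ 2 / 2) ≤ 1 := by nlinarith
  have h4 : 0 < 1 + x + x ^ 2 / 2 := by positivity
  have h5 : 1 ≤ (1 - x + x ^ 2 / 2) * (1 + x + x ^ 2 / 2) := by nlinarith [sq_nonneg (x^2)]
  exact le_of_mul_le_mul_right (h3.trans h5) h4

/-- flip coordinate `i` -/
def flp {n : ℕ} (i : Fin n) (x : Fin n → Bool) : Fin n → Bool :=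
  fun j => if j = i then !(x j) else x j

lemma flp_flp {n : ℕ} (i : Fin n) (x : Fin n → Bool) : flp i (flp i x) = x := by
  funext j; unfold flp; split_ifs <;> simp

lemma padTo_flp_of_not_mem {n : ℕ} (M : Finset (Fin n)) (i : Fin n) (hi : i ∉ M)
    (x : Fin n → Bool) : padTo M (flp i x) = padTo M x := by
  funext j; unfold padTo flp
  by_cases hj : j ∈ M
  · have : j ≠ i := fun h => hi (h ▸ hj)
    simp [this]
  · simp [hj]

lemma padTo_flp_ne {n : ℕ} (M : Finset (Fin n)) (i : Fin n) (hi : i ∈ M)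
    (x : Fin n → Bool) : padTo M (flp i x) ≠ padTo M x := by
  intro h
  have := congrFun h i
  simp [padTo, flp, hi] at this

lemma padTo_flp {n : ℕ} (M : Finset (Fin n)) (i : Fin n) (hi : i ∈ M)
    (x : Fin n → Bool) : padTo M (flp i x) = flp i (padTo M x) := by
  funext j; unfold padTo flp
  by_cases hj : j = i
  · subst hj; simp [hi]
  · simp [hj]

lemma card_bucket {n : ℕ} (M : Finset (Fin n)) (y : Fin n → Bool) :
    (Finset.univ.filter (fun x : Fin n → Bool => padTo M x = y)).card ≤ 2 ^ (n - M.card) := by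
  classical
  have h : (2 : ℕ) ^ (n - M.card) = (Finset.univ : Finset ({j // j ∈ Mᶜ} → Bool)).card := by
    rw [Finset.card_univ, Fintype.card_fun, Fintype.card_bool, Fintype.card_coe,
      Finset.card_compl, Fintype.card_fin]
  rw [h]
  refine Finset.card_le_card_of_injOn (fun x j => x j.1) (fun _ _ => Finset.mem_coe.2 (Finset.mem_univ _)) ?_
  intro a ha b hb hab
  simp only [Finset.coe_filter, Finset.mem_univ, true_and, Set.mem_ofPred_eq] at ha hb
  funext j
  by_cases hj : j ∈ M
  · have := congrFun (ha.trans hb.symm) j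
    simpa [padTo, hj] using this
  · exact congrFun hab ⟨j, by simpa using hj⟩

lemma card_diff_le {V : Type*} [Fintype V] [DecidableEq V] (f g : V → Bool) (τ : V → V)
    (hτ : Function.Injective τ) (hg : ∀ x, g (τ x) = g x) :
    (Finset.univ.filter (fun x => f x ≠ f (τ x))).card
      ≤ 2 * (Finset.univ.filter (fun x => f x ≠ g x)).card := by
  have h1 : Finset.univ.filter (fun x => f x ≠ f (τ x)) ⊆
      Finset.univ.filter (fun x => f x ≠ g x) ∪
      Finset.univ.filter (fun x => f (τ x) ≠ g (τ x)) := by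
    intro x hx
    simp only [Finset.mem_filter, Finset.mem_univ, true_and, Finset.mem_union] at hx ⊢
    by_contra hc
    push Not at hc
    exact hx (by rw [hc.1, hc.2, hg])
  have h2 : (Finset.univ.filter (fun x => f (τ x) ≠ g (τ x))).card ≤
      (Finset.univ.filter (fun x => f x ≠ g x)).card := by
    refine Finset.card_le_card_of_injOn τ ?_ hτ.injOn
    intro x hx
    simpa using hx
  have := (Finset.card_le_card h1).trans (Finset.card_union_le _ _)
  omega

/-- sign -/
def sg (b : Bool) : ℝ := if b then -1 else 1

lemma sg_not (b : Bool) : sg (!b) = - sg b := by cases b <;> simp [sg]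

lemma sg_abs (b : Bool) : |sg b| = 1 := by cases b <;> simp [sg]

lemma sg_mul (a b : Bool) : sg a * sg b = 1 - 2 * (if a ≠ b then 1 else 0) := by
  cases a <;> cases b <;> simp [sg] <;> norm_num

lemma sum_eq_zero_of_invol {Z : Type*} [Fintype Z] (τ : Z → Z) (hτ : Function.Involutive τ)
    (F : Z → ℝ) (hF : ∀ z, F (τ z) = - F z) : ∑ z, F z = 0 := by
  have h := Equiv.sum_comp hτ.toPerm F
  simp only [Function.Involutive.coe_toPerm, hF, Finset.sum_neg_distrib] at h
  linarith

/-- correlation with the shift in direction `i` -/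
def corr {n : ℕ} (f : (Fin n → Bool) → Bool) (i : Fin n) : ℝ :=
  ∑ x, sg (f x) * sg (f (flp i x))

lemma sum_corr_sq {n : ℕ} (M : Finset (Fin n)) (S : (Fin n → Bool) → Finset (Fin n))
    (i : Fin n) (hi : i ∈ M) :
    ∑ z : (Fin n → Bool) → (Fin n → Bool) → Bool, corr (buildF M S z) i ^ 2
      ≤ (2 ^ n * (2 * 2 ^ (n - M.card))) *
        (Fintype.card ((Fin n → Bool) → (Fin n → Bool) → Bool) : ℝ) := by
  classical
  set C : ℝ := (Fintype.card ((Fin n → Bool) → (Fin n → Bool) → Bool) : ℝ) with hC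
  have hexp : ∑ z : (Fin n → Bool) → (Fin n → Bool) → Bool, corr (buildF M S z) i ^ 2
      = ∑ x : Fin n → Bool, ∑ x' : Fin n → Bool,
          ∑ z : (Fin n → Bool) → (Fin n → Bool) → Bool,
          (sg (buildF M S z x) * sg (buildF M S z (flp i x))) *
          (sg (buildF M S z x') * sg (buildF M S z (flp i x'))) := by
    simp only [corr, sq, Finset.sum_mul_sum]
    rw [Finset.sum_comm]
    refine Finset.sum_congr rfl fun x _ => ?_
    rw [Finset.sum_comm]
  have hterm : ∀ x x' : Fin n → Bool,
      ∑ z : (Fin n → Bool) → (Fin n → Bool) → Bool,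
          (sg (buildF M S z x) * sg (buildF M S z (flp i x))) *
          (sg (buildF M S z x') * sg (buildF M S z (flp i x')))
      ≤ (if padTo M x' = padTo M x then C else 0) +
        (if padTo M x' = padTo M (flp i x) then C else 0) := by
    intro x x'
    have hC0 : 0 ≤ C := Nat.cast_nonneg _
    have hle : ∑ z : (Fin n → Bool) → (Fin n → Bool) → Bool,
          (sg (buildF M S z x) * sg (buildF M S z (flp i x))) *
          (sg (buildF M S z x') * sg (buildF M S z (flp i x'))) ≤ C := by
      have : C = ∑ z : (Fin n → Bool) → (Fin n → Bool) → Bool, (1 : ℝ) := by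
        simp [hC]
      rw [this]
      refine Finset.sum_le_sum fun z _ => ?_
      refine (le_abs_self _).trans ?_
      simp [abs_mul, sg_abs]
    by_cases h1 : padTo M x' = padTo M x
    · rw [if_pos h1]
      refine hle.trans ?_
      split_ifs <;> linarith
    · by_cases h2 : padTo M x' = padTo M (flp i x)
      · rw [if_neg h1, if_pos h2]; linarith
      · rw [if_neg h1, if_neg h2]
        refine le_of_eq ?_
        rw [add_zero]
        have h3 := padTo_flp_ne M i hi x
        have h4 : padTo M (flp i x') ≠ padTo M x := by
          rw [padTo_flp M i hi]
          intro h
          apply h2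
          rw [padTo_flp M i hi, ← h, flp_flp]
        refine sum_eq_zero_of_invol
          (fun z y v => if y = padTo M x then !(z y v) else z y v) ?_ _ ?_
        · intro z
          funext y v
          by_cases hy : y = padTo M x <;> simp [hy]
        · intro z
          simp only [buildF, h1, h3, h4, if_true, if_false, sg_not]
          ring
  rw [hexp]
  calc _ ≤ ∑ x : Fin n → Bool, ∑ x' : Fin n → Bool, ((if padTo M x' = padTo M x then C else 0) +
        (if padTo M x' = padTo M (flp i x) then C else 0)) :=
        Finset.sum_le_sum fun x _ => Finset.sum_le_sum fun x' _ => hterm x x'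
    _ ≤ ∑ x : Fin n → Bool, (2 * 2 ^ (n - M.card)) * C := by
        refine Finset.sum_le_sum fun x _ => ?_
        rw [Finset.sum_add_distrib, ← Finset.sum_filter, ← Finset.sum_filter, Finset.sum_const,
          Finset.sum_const, nsmul_eq_mul, nsmul_eq_mul, ← add_mul]
        refine mul_le_mul_of_nonneg_right ?_ (Nat.cast_nonneg _)
        have a1 : ((Finset.univ.filter (fun x' : Fin n → Bool => padTo M x' = padTo M x)).card : ℝ)
          ≤ 2 ^ (n - M.card) := by exact_mod_cast card_bucket M _
        have a2 : ((Finset.univ.filter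
          (fun x' : Fin n → Bool => padTo M x' = padTo M (flp i x))).card : ℝ)
          ≤ 2 ^ (n - M.card) := by exact_mod_cast card_bucket M _
        linarith
    _ = _ := by
        rw [Finset.sum_const, Finset.card_univ, nsmul_eq_mul]
        simp; ring

lemma card_ne_of_corr {n : ℕ} (f : (Fin n → Bool) → Bool) (i : Fin n)
    (h : corr f i < 2 ^ n / 3) :
    (2 : ℝ) ^ n / 3 ≤ ((Finset.univ.filter (fun x => f x ≠ f (flp i x))).card : ℝ) := by
  have : corr f i = 2 ^ n - 2 * ((Finset.univ.filter (fun x => f x ≠ f (flp i x))).card : ℝ) := by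
    unfold corr
    simp only [sg_mul, Finset.sum_sub_distrib, ← Finset.mul_sum]
    rw [Finset.sum_boole]
    simp
  linarith

/-- expectation over `S, z` -/
noncomputable def Ex (n : ℕ) (A : Finset (Fin n)) (ρ : ℝ)
    (F : ((Fin n → Bool) → Finset (Fin n)) → ((Fin n → Bool) → (Fin n → Bool) → Bool) → ℝ) : ℝ :=
  ∑ S : (Fin n → Bool) → Finset (Fin n),
    ∑ z : (Fin n → Bool) → (Fin n → Bool) → Bool,
      F S z * (∏ y : Fin n → Bool, pSet A ρ (S y)) /
        (Fintype.card ((Fin n → Bool) → (Fin n → Bool) → Bool) : ℝ)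

lemma Ex_mono {n : ℕ} {A : Finset (Fin n)} {ρ : ℝ} (h0 : 0 ≤ ρ) (h1 : ρ ≤ 1)
    {F G : ((Fin n → Bool) → Finset (Fin n)) → ((Fin n → Bool) → (Fin n → Bool) → Bool) → ℝ}
    (h : ∀ S z, F S z ≤ G S z) : Ex n A ρ F ≤ Ex n A ρ G := by
  unfold Ex
  refine Finset.sum_le_sum fun S _ => Finset.sum_le_sum fun z _ => ?_
  have : 0 ≤ ∏ y : Fin n → Bool, pSet A ρ (S y) :=
    Finset.prod_nonneg fun y _ => pSet_nonneg _ _ h0 h1 _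
  exact div_le_div_of_nonneg_right (mul_le_mul_of_nonneg_right (h S z) this) (Nat.cast_nonneg _)

lemma Ex_sum {n : ℕ} {A : Finset (Fin n)} {ρ : ℝ} {ι : Type*} (s : Finset ι)
    (F : ι → ((Fin n → Bool) → Finset (Fin n)) → ((Fin n → Bool) → (Fin n → Bool) → Bool) → ℝ) :
    Ex n A ρ (fun S z => ∑ i ∈ s, F i S z) = ∑ i ∈ s, Ex n A ρ (F i) := by
  unfold Ex
  rw [Finset.sum_comm (s := s)]
  refine Finset.sum_congr rfl fun S _ => ?_
  rw [Finset.sum_comm (s := s)]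
  refine Finset.sum_congr rfl fun z _ => ?_
  rw [Finset.sum_mul, Finset.sum_div]

lemma Ex_sub {n : ℕ} {A : Finset (Fin n)} {ρ : ℝ}
    (F G : ((Fin n → Bool) → Finset (Fin n)) → ((Fin n → Bool) → (Fin n → Bool) → Bool) → ℝ) :
    Ex n A ρ (fun S z => F S z - G S z) = Ex n A ρ F - Ex n A ρ G := by
  unfold Ex
  simp only [← Finset.sum_sub_distrib, sub_mul, sub_div]

lemma Ex_const_mul {n : ℕ} {A : Finset (Fin n)} {ρ : ℝ} (c : ℝ)
    (F : ((Fin n → Bool) → Finset (Fin n)) → ((Fin n → Bool) → (Fin n → Bool) → Bool) → ℝ) :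
    Ex n A ρ (fun S z => c * F S z) = c * Ex n A ρ F := by
  unfold Ex
  simp only [Finset.mul_sum, mul_assoc, mul_div_assoc]

lemma Ex_prod {n : ℕ} {A : Finset (Fin n)} {ρ : ℝ}
    (G : (Fin n → Bool) → Finset (Fin n) → ((Fin n → Bool) → Bool) → ℝ) :
    Ex n A ρ (fun S z => ∏ y, G y (S y) (z y)) =
      ∏ y, ∑ T : Finset (Fin n), ∑ ζ : (Fin n → Bool) → Bool,
        G y T ζ * pSet A ρ T / (Fintype.card ((Fin n → Bool) → Bool) : ℝ) := by
  classical
  rw [Finset.prod_univ_sum, Fintype.piFinset_univ]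
  unfold Ex
  refine Finset.sum_congr rfl fun S _ => ?_
  rw [Finset.prod_univ_sum, Fintype.piFinset_univ]
  refine Finset.sum_congr rfl fun z _ => ?_
  rw [Finset.prod_div_distrib, Finset.prod_mul_distrib]
  congr 1
  rw [Finset.prod_const, Fintype.card_fun, Finset.card_univ]
  push_cast
  rfl

lemma sum_one_card {Z : Type*} [Fintype Z] [Nonempty Z] (c : ℝ) :
    ∑ _ζ : Z, c / (Fintype.card Z : ℝ) = c := by
  rw [Finset.sum_const, Finset.card_univ, nsmul_eq_mul]
  have : (Fintype.card Z : ℝ) ≠ 0 := by exact_mod_cast Fintype.card_ne_zero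
  field_simp

lemma Ex_one {n : ℕ} {A : Finset (Fin n)} {ρ : ℝ} : Ex n A ρ (fun _ _ => 1) = 1 := by
  have := Ex_prod (n := n) (A := A) (ρ := ρ) (fun _ _ _ => 1)
  simp only [Finset.prod_const_one, one_mul, sum_one_card, sum_pSet] at this
  exact this

open Classical in
lemma case1 {n : ℕ} (M A : Finset (Fin n)) {ρ : ℝ} (h0 : 0 ≤ ρ) (h1 : ρ ≤ 1) (i : Fin n)
    (hi : i ∈ M) :
    Ex n A ρ (fun S z => if corr (buildF M S z) i < 2 ^ n / 3 then 0 else 1)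
      ≤ 18 * 2 ^ (n - M.card) / 2 ^ n := by
  have hK : (0 : ℝ) < 2 ^ n := by positivity
  calc _ ≤ Ex n A ρ (fun S z => (9 / (2 ^ n * 2 ^ n)) * corr (buildF M S z) i ^ 2) := by
        refine Ex_mono h0 h1 fun S z => ?_
        split_ifs with h
        · positivity
        · push Not at h
          rw [div_mul_eq_mul_div, le_div_iff₀ (by positivity)]
          nlinarith
    _ = (9 / (2 ^ n * 2 ^ n)) * Ex n A ρ (fun S z => corr (buildF M S z) i ^ 2) :=
        Ex_const_mul _ _
    _ ≤ (9 / (2 ^ n * 2 ^ n)) * (2 ^ n * (2 * 2 ^ (n - M.card))) := by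
        refine mul_le_mul_of_nonneg_left ?_ (by positivity)
        calc _ ≤ Ex n A ρ (fun S z => (2 ^ n * (2 * 2 ^ (n - M.card))) * 1) := by
              unfold Ex
              refine Finset.sum_le_sum fun S _ => ?_
              rw [← Finset.sum_div, ← Finset.sum_div, ← Finset.sum_mul, ← Finset.sum_mul]
              refine div_le_div_of_nonneg_right (mul_le_mul_of_nonneg_right ?_ ?_)
                (Nat.cast_nonneg _)
              · refine (sum_corr_sq M S i hi).trans (le_of_eq ?_)
                rw [Finset.sum_const, Finset.card_univ, nsmul_eq_mul]; ring
              · exact Finset.prod_nonneg fun y _ => pSet_nonneg _ _ h0 h1 _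
          _ = _ := by rw [Ex_const_mul, Ex_one, mul_one]
    _ = _ := by field_simp; ring

/-- flip a canonical element of `T ∩ U`, if there is any -/
def flipU {n : ℕ} (U T : Finset (Fin n)) (x : Fin n → Bool) : Fin n → Bool :=
  if h : (T ∩ U).Nonempty then flp ((T ∩ U).min' h) x else x

lemma flipU_flipU {n : ℕ} (U T : Finset (Fin n)) (x : Fin n → Bool) :
    flipU U T (flipU U T x) = x := by
  unfold flipU; split_ifs
  · exact flp_flp _ _
  · rfl

lemma padTo_flipU {n : ℕ} (M U T : Finset (Fin n)) (hU : ∀ u ∈ U, u ∉ M) (x : Fin n → Bool) :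
    padTo M (flipU U T x) = padTo M x := by
  unfold flipU; split_ifs with h
  · refine padTo_flp_of_not_mem _ _ (hU _ ?_) _
    exact (Finset.mem_inter.1 ((T ∩ U).min'_mem h)).2
  · rfl

lemma sum_ne_half {V : Type*} [Fintype V] [DecidableEq V] (a b : V) (hab : b ≠ a) :
    ∑ ζ : V → Bool, (if ζ a ≠ ζ b then (1 : ℝ) else 0) / (Fintype.card (V → Bool) : ℝ) = 1 / 2 := by
  have h : ∑ ζ : V → Bool, sg (ζ a) * sg (ζ b) = 0 := by
    refine sum_eq_zero_of_invol (fun ζ v => if v = a then !(ζ v) else ζ v) ?_ _ ?_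
    · intro ζ; funext v; by_cases hv : v = a <;> simp [hv]
    · intro ζ
      simp [hab, sg_not]
  simp only [sg_mul, Finset.sum_sub_distrib, ← Finset.mul_sum] at h
  rw [← Finset.sum_div]
  rw [Finset.sum_const, Finset.card_univ, nsmul_eq_mul, mul_one] at h
  have hc : (Fintype.card (V → Bool) : ℝ) ≠ 0 := by exact_mod_cast Fintype.card_ne_zero
  field_simp
  linarith

lemma half_avg {n : ℕ} (A U : Finset (Fin n)) (hU : U ⊆ A) (ρ : ℝ) (x : Fin n → Bool) :
    ∑ T : Finset (Fin n), ∑ ζ : (Fin n → Bool) → Bool,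
      (if ζ (padTo T x) ≠ ζ (padTo T (flipU U T x)) then (1 : ℝ) else 0) * pSet A ρ T
        / (Fintype.card ((Fin n → Bool) → Bool) : ℝ)
      = (1 - (1 - ρ) ^ U.card) / 2 := by
  rw [← sum_pSet_disj A U hU ρ, Finset.sum_div]
  refine Finset.sum_congr rfl fun T _ => ?_
  by_cases h : (T ∩ U).Nonempty
  · have hne : padTo T (flipU U T x) ≠ padTo T x := by
      unfold flipU; rw [dif_pos h]
      exact padTo_flp_ne _ _ (Finset.mem_inter.1 ((T ∩ U).min'_mem h)).1 _
    have := sum_ne_half _ _ hne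
    rw [if_pos h, one_mul]
    calc _ = (∑ ζ : (Fin n → Bool) → Bool,
      (if ζ (padTo T x) ≠ ζ (padTo T (flipU U T x)) then (1 : ℝ) else 0)
        / (Fintype.card ((Fin n → Bool) → Bool) : ℝ)) * pSet A ρ T := by
          rw [Finset.sum_mul]
          refine Finset.sum_congr rfl fun ζ _ => by ring
      _ = _ := by rw [this]; ring
  · have : flipU U T x = x := by unfold flipU; rw [dif_neg h]
    simp [h, this]

/-- number of disagreements in bucket `y` -/
def cntB {n : ℕ} (M U : Finset (Fin n)) (y : Fin n → Bool) (T : Finset (Fin n))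
    (ζ : (Fin n → Bool) → Bool) : ℝ :=
  ∑ x, if padTo M x = y then (if ζ (padTo T x) ≠ ζ (padTo T (flipU U T x)) then (1 : ℝ) else 0)
    else 0

lemma cntB_nonneg {n : ℕ} (M U : Finset (Fin n)) (y : Fin n → Bool) (T : Finset (Fin n))
    (ζ : (Fin n → Bool) → Bool) : 0 ≤ cntB M U y T ζ := by
  refine Finset.sum_nonneg fun x _ => ?_
  split_ifs <;> norm_num

lemma cntB_le {n : ℕ} (M U : Finset (Fin n)) (y : Fin n → Bool) (T : Finset (Fin n))
    (ζ : (Fin n → Bool) → Bool) : cntB M U y T ζ ≤ 2 ^ (n - M.card) := by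
  have h : cntB M U y T ζ ≤ ∑ x : Fin n → Bool, if padTo M x = y then (1 : ℝ) else 0 := by
    refine Finset.sum_le_sum fun x _ => ?_
    split_ifs <;> norm_num
  refine h.trans ?_
  rw [Finset.sum_boole]
  exact_mod_cast card_bucket M y

lemma card_eq_sum_cntB {n : ℕ} (M U : Finset (Fin n)) (hU : ∀ u ∈ U, u ∉ M)
    (S : (Fin n → Bool) → Finset (Fin n))
    (z : (Fin n → Bool) → (Fin n → Bool) → Bool) :
    ((Finset.univ.filter (fun x => buildF M S z x ≠
      buildF M S z (flipU U (S (padTo M x)) x))).card : ℝ) = ∑ y, cntB M U y (S y) (z y) := by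
  unfold cntB
  rw [Finset.sum_comm, ← Finset.sum_boole]
  refine Finset.sum_congr rfl fun x _ => ?_
  rw [Finset.sum_ite_eq]
  simp only [Finset.mem_univ, if_true, buildF, padTo_flipU M U _ hU]

lemma sum_avg_cntB {n : ℕ} (M A U : Finset (Fin n)) (hU : U ⊆ A) (ρ : ℝ) :
    ∑ y : Fin n → Bool, ∑ T : Finset (Fin n), ∑ ζ : (Fin n → Bool) → Bool,
      cntB M U y T ζ * pSet A ρ T / (Fintype.card ((Fin n → Bool) → Bool) : ℝ)
      = 2 ^ n * ((1 - (1 - ρ) ^ U.card) / 2) := by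
  have h : (2 : ℝ) ^ n * ((1 - (1 - ρ) ^ U.card) / 2)
      = ∑ x : Fin n → Bool, ((1 - (1 - ρ) ^ U.card) / 2) := by
    rw [Finset.sum_const, Finset.card_univ, nsmul_eq_mul]; simp
  rw [h, Finset.sum_congr rfl (fun x _ => (half_avg A U hU ρ x).symm)]
  rw [Finset.sum_comm, Finset.sum_comm (s := (Finset.univ : Finset (Fin n → Bool)))]
  refine Finset.sum_congr rfl fun T _ => ?_
  rw [Finset.sum_comm, Finset.sum_comm (s := (Finset.univ : Finset (Fin n → Bool)))]
  refine Finset.sum_congr rfl fun ζ _ => ?_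
  rw [← Finset.sum_div, ← Finset.sum_div, ← Finset.sum_mul, ← Finset.sum_mul]
  congr 2
  unfold cntB
  rw [Finset.sum_comm]
  refine Finset.sum_congr rfl fun x _ => ?_
  rw [Finset.sum_ite_eq]
  simp

open Classical in
lemma case2 {n : ℕ} (M A U : Finset (Fin n)) (hU : U ⊆ A) (hM : ∀ u ∈ U, u ∉ M)
    {ρ : ℝ} (h0 : 0 ≤ ρ) (h1 : ρ ≤ 1) (θ : ℝ) :
    Ex n A ρ (fun S z => if θ ≤ ((Finset.univ.filter (fun x => buildF M S z x ≠
      buildF M S z (flipU U (S (padTo M x)) x))).card : ℝ) then 0 else 1)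
      ≤ Real.exp ((θ / 4 - 7 / 64 * (2 ^ n * (1 - (1 - ρ) ^ U.card))) / 2 ^ (n - M.card)) := by
  set K : ℝ := 2 ^ (n - M.card) with hK
  have hK0 : 0 < K := by positivity
  have step1 : Ex n A ρ (fun S z => if θ ≤ ((Finset.univ.filter (fun x => buildF M S z x ≠
      buildF M S z (flipU U (S (padTo M x)) x))).card : ℝ) then 0 else 1)
      ≤ Ex n A ρ (fun S z => Real.exp (θ / 4 / K) *
        ∏ y, Real.exp (-(cntB M U y (S y) (z y) / 4 / K))) := by
    refine Ex_mono h0 h1 fun S z => ?_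
    rw [card_eq_sum_cntB M U hM, ← Real.exp_sum, ← Real.exp_add]
    split_ifs with h
    · positivity
    · push Not at h
      rw [Finset.sum_neg_distrib, ← Finset.sum_div, ← Finset.sum_div]
      apply Real.one_le_exp
      rw [← sub_eq_add_neg, ← sub_div]
      apply div_nonneg _ hK0.le
      linarith
  refine step1.trans ?_
  rw [Ex_const_mul, Ex_prod (fun y T ζ => Real.exp (-(cntB M U y T ζ / 4 / K)))]
  set B : (Fin n → Bool) → ℝ := fun y => ∑ T : Finset (Fin n), ∑ ζ : (Fin n → Bool) → Bool,
      cntB M U y T ζ * pSet A ρ T / (Fintype.card ((Fin n → Bool) → Bool) : ℝ) with hB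
  have step2 : ∀ y, ∑ T : Finset (Fin n), ∑ ζ : (Fin n → Bool) → Bool,
        Real.exp (-(cntB M U y T ζ / 4 / K)) * pSet A ρ T /
          (Fintype.card ((Fin n → Bool) → Bool) : ℝ) ≤ Real.exp (-(7 / 32 / K * B y)) := by
    intro y
    have e1 : ∀ T ζ, Real.exp (-(cntB M U y T ζ / 4 / K)) ≤ 1 - 7 / 32 / K * cntB M U y T ζ := by
      intro T ζ
      have a0 := cntB_nonneg M U y T ζ
      have a1 := cntB_le M U y T ζ
      rw [← hK] at a1
      have b0 : 0 ≤ cntB M U y T ζ / K := by positivity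
      have b1 : cntB M U y T ζ / K ≤ 1 := by rw [div_le_one hK0]; exact a1
      have := exp_neg_le (cntB M U y T ζ / 4 / K) (by positivity)
      refine this.trans ?_
      have c1 : cntB M U y T ζ / 4 / K = (cntB M U y T ζ / K) / 4 := by ring
      have c2 : 7 / 32 / K * cntB M U y T ζ = 7 / 32 * (cntB M U y T ζ / K) := by ring
      rw [c1, c2]
      nlinarith
    calc _ ≤ ∑ T : Finset (Fin n), ∑ ζ : (Fin n → Bool) → Bool,
          (pSet A ρ T / (Fintype.card ((Fin n → Bool) → Bool) : ℝ)
          - 7 / 32 / K * (cntB M U y T ζ * pSet A ρ T /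
            (Fintype.card ((Fin n → Bool) → Bool) : ℝ))) := by
          refine Finset.sum_le_sum fun T _ => Finset.sum_le_sum fun ζ _ => ?_
          have q : 0 ≤ pSet A ρ T / (Fintype.card ((Fin n → Bool) → Bool) : ℝ) :=
            div_nonneg (pSet_nonneg _ _ h0 h1 _) (Nat.cast_nonneg _)
          have := mul_le_mul_of_nonneg_right (e1 T ζ) q
          calc _ = _ := mul_div_assoc _ _ _
            _ ≤ _ := this
            _ = _ := by ring
      _ = 1 - 7 / 32 / K * B y := by
          simp only [Finset.sum_sub_distrib, ← Finset.mul_sum, sum_one_card, sum_pSet, hB]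
      _ ≤ _ := Real.one_sub_le_exp_neg _
  calc _ ≤ Real.exp (θ / 4 / K) * ∏ y, Real.exp (-(7 / 32 / K * B y)) := by
        refine mul_le_mul_of_nonneg_left ?_ (Real.exp_pos _).le
        refine Finset.prod_le_prod (fun y _ => ?_) (fun y _ => step2 y)
        refine Finset.sum_nonneg fun T _ => Finset.sum_nonneg fun ζ _ => ?_
        exact div_nonneg (mul_nonneg (Real.exp_pos _).le (pSet_nonneg _ _ h0 h1 _))
          (Nat.cast_nonneg _)
    _ = _ := by
        rw [← Real.exp_sum, ← Real.exp_add, Finset.sum_neg_distrib, ← Finset.mul_sum, hB,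
          sum_avg_cntB M A U hU ρ]
        congr 1
        field_simp
        ring

lemma far_of_good {n k : ℕ} (M A : Finset (Fin n)) (hMA : ∀ u ∈ A, u ∉ M) (s ε : ℝ)
    (hε : ε ≤ 1 / 6) (hs : (k : ℝ) + s ≤ (A.card : ℝ) + (M.card : ℝ))
    (S : (Fin n → Bool) → Finset (Fin n))
    (z : (Fin n → Bool) → (Fin n → Bool) → Bool)
    (hg1 : ∀ i ∈ M, corr (buildF M S z) i < 2 ^ n / 3)
    (hg2 : ∀ U, U ⊆ A → s ≤ (U.card : ℝ) → 2 * ε * 2 ^ n ≤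
      ((Finset.univ.filter (fun x => buildF M S z x ≠
        buildF M S z (flipU U (S (padTo M x)) x))).card : ℝ)) :
    FarFromJuntas n k ε (buildF M S z) := by
  intro g hg
  obtain ⟨J, hJk, hJ⟩ := hg
  by_cases hMJ : M ⊆ J
  · have hc' : s ≤ ((A \ J).card : ℝ) := by
      have e1 : (A \ J).card + (A ∩ J).card = A.card := Finset.card_sdiff_add_card_inter A J
      have e2 : (A ∩ J).card + M.card ≤ J.card := by
        rw [← Finset.card_union_of_disjoint]
        · exact Finset.card_le_card (Finset.union_subset Finset.inter_subset_right hMJ)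
        · rw [Finset.disjoint_left]
          intro u hu
          exact hMA u (Finset.mem_inter.1 hu).1
      have e3 : A.card + M.card ≤ (A \ J).card + k := by omega
      have e4 : (A.card : ℝ) + M.card ≤ (A \ J).card + k := by exact_mod_cast e3
      linarith
    have h2 := hg2 (A \ J) Finset.sdiff_subset hc'
    have hM' : ∀ u ∈ A \ J, u ∉ M := fun u hu => hMA u (Finset.mem_sdiff.1 hu).1
    have h3 := card_diff_le (buildF M S z) g (fun x => flipU (A \ J) (S (padTo M x)) x) ?_ ?_
    · have h3' : ((Finset.univ.filter (fun x => buildF M S z x ≠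
        buildF M S z (flipU (A \ J) (S (padTo M x)) x))).card : ℝ) ≤
        2 * ((Finset.univ.filter (fun x => buildF M S z x ≠ g x)).card : ℝ) := by
        exact_mod_cast h3
      linarith
    · apply Function.Involutive.injective
      intro x
      simp only [padTo_flipU M _ _ hM', flipU_flipU]
    · intro x
      apply hJ
      intro j hj
      have hpad := padTo_flipU J (A \ J) (S (padTo M x)) (fun u hu => (Finset.mem_sdiff.1 hu).2) x
      have := congrFun hpad j
      simpa [padTo, hj] using this
  · obtain ⟨i, hiM, hiJ⟩ := Finset.not_subset.1 hMJ
    have h2 := card_ne_of_corr _ i (hg1 i hiM)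
    have h3 := card_diff_le (buildF M S z) g (flp i)
      (Function.Involutive.injective (flp_flp i)) ?_
    · have h3' : ((Finset.univ.filter (fun x => buildF M S z x ≠
        buildF M S z (flp i x))).card : ℝ) ≤
        2 * ((Finset.univ.filter (fun x => buildF M S z x ≠ g x)).card : ℝ) := by
        exact_mod_cast h3
      have : (0 : ℝ) < 2 ^ n := by positivity
      nlinarith
    · intro x
      apply hJ
      intro j hj
      have : j ≠ i := fun h => hiJ (h ▸ hj)
      simp [flp, this]

lemma prSH_ge {n k : ℕ} (M A : Finset (Fin n)) (hMA : ∀ u ∈ A, u ∉ M) (s ε ρ b : ℝ)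
    (h0 : 0 ≤ ρ) (h1 : ρ ≤ 1) (hb0 : 0 ≤ b)
    (hε : ε ≤ 1 / 6) (hs : (k : ℝ) + s ≤ (A.card : ℝ) + (M.card : ℝ))
    (hb : ∀ u : ℕ, s ≤ (u : ℝ) →
      Real.exp ((2 * ε * 2 ^ n / 4 - 7 / 64 * (2 ^ n * (1 - (1 - ρ) ^ u))) / 2 ^ (n - M.card)) ≤ b) :
    1 - n * (18 * 2 ^ (n - M.card) / 2 ^ n) - 2 ^ n * b ≤ prSH n M A ρ (FarFromJuntas n k ε) := by
  classical
  set F1 : Fin n → ((Fin n → Bool) → Finset (Fin n)) →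
      ((Fin n → Bool) → (Fin n → Bool) → Bool) → ℝ :=
    fun i S z => if corr (buildF M S z) i < 2 ^ n / 3 then 0 else 1 with hF1
  set F2 : Finset (Fin n) → ((Fin n → Bool) → Finset (Fin n)) →
      ((Fin n → Bool) → (Fin n → Bool) → Bool) → ℝ :=
    fun U S z => if 2 * ε * 2 ^ n ≤ ((Finset.univ.filter (fun x => buildF M S z x ≠
      buildF M S z (flipU U (S (padTo M x)) x))).card : ℝ) then 0 else 1 with hF2
  set P := A.powerset.filter (fun U => s ≤ (U.card : ℝ)) with hP
  have hF1n : ∀ i S z, 0 ≤ F1 i S z := by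
    intro i S z; simp only [hF1]; split_ifs <;> norm_num
  have hF2n : ∀ i S z, 0 ≤ F2 i S z := by
    intro i S z; simp only [hF2]; split_ifs <;> norm_num
  have key : Ex n A ρ (fun S z => (1 - ∑ i ∈ M, F1 i S z) - ∑ U ∈ P, F2 U S z)
      ≤ prSH n M A ρ (FarFromJuntas n k ε) := by
    have : prSH n M A ρ (FarFromJuntas n k ε) =
        Ex n A ρ (fun S z => if FarFromJuntas n k ε (buildF M S z) then 1 else 0) := by
      unfold prSH Ex
      refine Finset.sum_congr rfl fun S _ => Finset.sum_congr rfl fun z _ => ?_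
      congr
    rw [this]
    refine Ex_mono h0 h1 fun S z => ?_
    have q1 : 0 ≤ ∑ i ∈ M, F1 i S z := Finset.sum_nonneg fun i _ => hF1n i S z
    have q2 : 0 ≤ ∑ U ∈ P, F2 U S z := Finset.sum_nonneg fun i _ => hF2n i S z
    by_cases hfar : FarFromJuntas n k ε (buildF M S z)
    · rw [if_pos hfar]; linarith
    · rw [if_neg hfar]
      by_contra hc
      push Not at hc
      apply hfar
      apply far_of_good M A hMA s ε hε hs S z
      · intro i hi
        by_contra hcon
        have : F1 i S z = 1 := by simp only [hF1]; rw [if_neg hcon]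
        have := Finset.single_le_sum (f := fun i => F1 i S z) (fun i _ => hF1n i S z) hi
        linarith
      · intro U hUA hUs
        by_contra hcon
        have : F2 U S z = 1 := by simp only [hF2]; rw [if_neg hcon]
        have := Finset.single_le_sum (f := fun i => F2 i S z) (s := P) (fun i _ => hF2n i S z)
          (Finset.mem_filter.2 ⟨Finset.mem_powerset.2 hUA, hUs⟩)
        linarith
  refine le_trans ?_ key
  rw [Ex_sub, Ex_sub, Ex_one, Ex_sum, Ex_sum]
  have r1 : ∑ i ∈ M, Ex n A ρ (F1 i) ≤ n * (18 * 2 ^ (n - M.card) / 2 ^ n) := by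
    calc _ ≤ ∑ i ∈ M, (18 * 2 ^ (n - M.card) / 2 ^ n : ℝ) :=
          Finset.sum_le_sum fun i hi => by
            have := case1 M A h0 h1 i hi
            convert this using 4
      _ = M.card * (18 * 2 ^ (n - M.card) / 2 ^ n) := by
          rw [Finset.sum_const, nsmul_eq_mul]
      _ ≤ _ := by
          refine mul_le_mul_of_nonneg_right ?_ (by positivity)
          have := Finset.card_le_univ M
          rw [Fintype.card_fin] at this
          exact_mod_cast this
  have r2 : ∑ U ∈ P, Ex n A ρ (F2 U) ≤ 2 ^ n * b := by
    calc _ ≤ ∑ U ∈ P, b := Finset.sum_le_sum fun U hU => by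
            obtain ⟨hUA, hUs⟩ := Finset.mem_filter.1 hU
            have hUA := Finset.mem_powerset.1 hUA
            have := case2 M A U hUA (fun u hu => hMA u (hUA hu)) h0 h1 (2 * ε * 2 ^ n)
            refine le_trans (le_of_eq ?_) (this.trans (hb _ hUs))
            simp only [hF2]
      _ = P.card * b := by rw [Finset.sum_const, nsmul_eq_mul]
      _ ≤ _ := by
          refine mul_le_mul_of_nonneg_right ?_ hb0
          have := Finset.card_le_univ P
          rw [Fintype.card_finset, Fintype.card_fin] at this
          exact_mod_cast this
  linarith

/-- lower tail for the size of `A` -/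
lemma tail_A {ι : Type*} [DecidableEq ι] [Fintype ι] (U : Finset ι) (ρ lam a : ℝ)
    (h0 : 0 ≤ ρ) (h1 : ρ ≤ 1) (hl : 0 ≤ lam) :
    1 - Real.exp (lam * a - U.card * ρ * (lam - lam ^ 2 / 2)) ≤
      ∑ A : Finset ι, pSet U ρ A * (if a ≤ (A.card : ℝ) then 1 else 0) := by
  have h : ∑ A : Finset ι, pSet U ρ A * (1 - (if a ≤ (A.card : ℝ) then (1 : ℝ) else 0)) ≤
      Real.exp (lam * a - U.card * ρ * (lam - lam ^ 2 / 2)) := by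
    calc _ ≤ ∑ A : Finset ι, Real.exp (lam * a) * (pSet U ρ A * Real.exp (-lam) ^ A.card) := by
          refine Finset.sum_le_sum fun A _ => ?_
          have hp := pSet_nonneg U ρ h0 h1 A
          rw [mul_left_comm]
          refine mul_le_mul_of_nonneg_left ?_ hp
          rw [← Real.exp_nat_mul, ← Real.exp_add]
          split_ifs with hA
          · simpa using (Real.exp_pos _).le
          · push Not at hA
            rw [sub_zero]
            apply Real.one_le_exp
            nlinarith
      _ = Real.exp (lam * a) * (ρ * Real.exp (-lam) + (1 - ρ)) ^ U.card := by
          rw [← Finset.mul_sum, sum_pSet_pow]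
      _ ≤ Real.exp (lam * a) * (Real.exp (-(ρ * (lam - lam ^ 2 / 2)))) ^ U.card := by
          refine mul_le_mul_of_nonneg_left ?_ (Real.exp_pos _).le
          refine pow_le_pow_left₀ ?_ ?_ _
          · have := (Real.exp_pos (-lam)).le
            have := mul_nonneg h0 this
            linarith
          · refine le_trans ?_ (Real.one_sub_le_exp_neg _)
            have := mul_le_mul_of_nonneg_left (exp_neg_le lam hl) h0
            linarith
      _ = _ := by
          rw [← Real.exp_nat_mul, ← Real.exp_add]
          congr 1
          ring
  simp only [mul_sub, mul_one, Finset.sum_sub_distrib, sum_pSet] at h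
  simp only [mul_sub, mul_ite, mul_one, mul_zero] at h ⊢
  linarith

lemma prD_ge {n t : ℕ} (ht : t ≤ n) (ρA ρ : ℝ) (E : ((Fin n → Bool) → Bool) → Prop)
    (a c lam : ℝ) (hA0 : 0 ≤ ρA) (hA1 : ρA ≤ 1) (h0 : 0 ≤ ρ) (h1 : ρ ≤ 1) (hl : 0 ≤ lam)
    (hc0 : 0 ≤ c)
    (hc : ∀ M A : Finset (Fin n), M.card = t → (∀ u ∈ A, u ∉ M) → a ≤ (A.card : ℝ) →
      c ≤ prSH n M A ρ E) :
    c * (1 - Real.exp (lam * a - ((n - t : ℕ) : ℝ) * ρA * (lam - lam ^ 2 / 2))) ≤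
      prD n t ρA ρ E := by
  classical
  have hpos : (0 : ℝ) < n.choose t := by exact_mod_cast Nat.choose_pos ht
  unfold prD
  rw [le_div_iff₀ hpos]
  have hcard : (Finset.univ.filter (fun M : Finset (Fin n) => M.card = t)).card = n.choose t := by
    have : Finset.univ.filter (fun M : Finset (Fin n) => M.card = t)
        = Finset.powersetCard t Finset.univ := by
      ext M; simp [Finset.mem_powersetCard]
    rw [this, Finset.card_powersetCard, Finset.card_univ, Fintype.card_fin]
  rw [← hcard, mul_comm, ← nsmul_eq_mul, ← Finset.sum_const]
  refine Finset.sum_le_sum fun M hM => ?_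
  have hM : M.card = t := (Finset.mem_filter.1 hM).2
  have hnn : ∀ A, 0 ≤ prSH n M A ρ E := by
    intro A
    unfold prSH
    refine Finset.sum_nonneg fun S _ => Finset.sum_nonneg fun z _ => ?_
    refine div_nonneg (mul_nonneg ?_ (Finset.prod_nonneg fun y _ => pSet_nonneg _ _ h0 h1 _))
      (Nat.cast_nonneg _)
    split_ifs <;> norm_num
  have ht := tail_A Mᶜ ρA lam a hA0 hA1 hl
  rw [Finset.card_compl, Fintype.card_fin, hM] at ht
  refine (mul_le_mul_of_nonneg_left ht hc0).trans ?_
  rw [Finset.mul_sum]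
  refine Finset.sum_le_sum fun A _ => ?_
  have hp := pSet_nonneg Mᶜ ρA hA0 hA1 A
  rw [mul_left_comm]
  by_cases hAM : A ⊆ Mᶜ
  · refine mul_le_mul_of_nonneg_left ?_ hp
    split_ifs with ha
    · rw [mul_one]
      exact hc M A hM (fun u hu => by simpa using hAM hu) ha
    · simpa using hnn A
  · simp [pSet, hAM]

end helpers

lemma tendsto_logb_div_sqrt :
    Filter.Tendsto (fun n : ℕ => Real.logb 2 n / Real.sqrt n) Filter.atTop (nhds 0) := by
  have h := (isLittleO_log_rpow_atTop (r := 1 / 2) (by norm_num)).tendsto_div_nhds_zero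
  have h2 := (h.const_mul (1 / Real.log 2)).comp (tendsto_natCast_atTop_atTop (R := ℝ))
  rw [mul_zero] at h2
  refine h2.congr fun n => ?_
  simp only [Function.comp, Real.logb, Real.sqrt_eq_rpow]
  ring

lemma asymp (δ β η : ℝ) (hδ : 0 < δ) (hβ : 0 < β) (hη : 0 < η) :
    ∀ᶠ n : ℕ in Filter.atTop,
      1 ≤ n ∧ Real.logb 2 n / Real.sqrt n ≤ 1 / 2 ∧
      δ * Real.sqrt n * Real.logb 2 n + 1 ≤ β * n ∧
      Real.exp (-(δ * Real.logb 2 n / 12)) ≤ 1 / 30 ∧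
      n * (18 / (2 : ℝ) ^ (β * n)) ≤ η ∧
      (2 : ℝ) ^ n * Real.exp (-(1 / 10 * (2 : ℝ) ^ (β * n))) ≤ η ∧
      Real.exp (1 - δ * Real.logb 2 n) ≤ η := by
  have hcast : Filter.Tendsto (fun n : ℕ => (n : ℝ)) Filter.atTop Filter.atTop :=
    tendsto_natCast_atTop_atTop
  have hL : Filter.Tendsto (fun n : ℕ => Real.logb 2 (n : ℝ)) Filter.atTop Filter.atTop :=
    (Real.tendsto_logb_atTop (by norm_num)).comp hcast
  have hκ : 0 < β * Real.log 2 := mul_pos hβ (Real.log_pos (by norm_num))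
  have hexp : Filter.Tendsto (fun n : ℕ => (n : ℝ) * Real.exp (-(β * Real.log 2) * n))
      Filter.atTop (nhds 0) := by
    have := (tendsto_rpow_mul_exp_neg_mul_atTop_nhds_zero 1 _ hκ).comp hcast
    refine this.congr fun n => ?_
    simp [Function.comp]
  have h2 : ∀ n : ℕ, (2 : ℝ) ^ (β * n) = Real.exp (β * Real.log 2 * n) := by
    intro n
    rw [Real.rpow_def_of_pos (by norm_num)]; congr 1; ring
  have hδ12 : (0 : ℝ) < δ / 12 := by positivity
  filter_upwards [Filter.eventually_ge_atTop 1,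
    tendsto_logb_div_sqrt.eventually_le_const (show (0 : ℝ) < 1 / 2 by norm_num),
    tendsto_logb_div_sqrt.eventually_le_const (show (0 : ℝ) < β / (2 * δ) by positivity),
    hcast.eventually_ge_atTop (2 / β),
    hL.eventually_ge_atTop ((-Real.log (1 / 30)) / (δ / 12)),
    hL.eventually_ge_atTop ((1 - Real.log η) / δ),
    hexp.eventually_le_const (show (0 : ℝ) < η / 18 by positivity),
    hexp.eventually_le_const (show (0 : ℝ) < 1 / 20 by norm_num),
    hcast.eventually_ge_atTop (-Real.log η)] with n n1 a1 a2 a3 a4 a5 a6 a7 a8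
  have hn0 : (0 : ℝ) < n := by exact_mod_cast n1
  have hr0 : 0 < Real.sqrt n := Real.sqrt_pos.2 hn0
  have hrr : Real.sqrt n * Real.sqrt n = n := Real.mul_self_sqrt hn0.le
  have hE := Real.exp_pos (β * Real.log 2 * n)
  have hEi : Real.exp (-(β * Real.log 2) * n) = (Real.exp (β * Real.log 2 * n))⁻¹ := by
    rw [← Real.exp_neg]; congr 1; ring
  refine ⟨n1, a1, ?_, ?_, ?_, ?_, ?_⟩
  · have b1 : δ * Real.sqrt n * Real.logb 2 n = δ * n * (Real.logb 2 n / Real.sqrt n) := by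
      rw [← hrr]
      simp only [Real.sqrt_mul_self hr0.le]
      field_simp
    have b2 : δ * n * (Real.logb 2 n / Real.sqrt n) ≤ δ * n * (β / (2 * δ)) :=
      mul_le_mul_of_nonneg_left a2 (by positivity)
    have b3 : δ * n * (β / (2 * δ)) = β * n / 2 := by field_simp
    rw [div_le_iff₀ hβ] at a3
    linarith
  · rw [← Real.le_log_iff_exp_le (by norm_num)]
    rw [div_le_iff₀ hδ12] at a4
    linarith
  · rw [h2]
    rw [hEi] at a6
    have : (n : ℝ) * (18 / Real.exp (β * Real.log 2 * n))
      = 18 * (n * (Real.exp (β * Real.log 2 * n))⁻¹) := by ring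
    rw [this]; linarith
  · rw [h2]
    rw [hEi, ← div_eq_mul_inv, div_le_iff₀ hE] at a7
    have c1 : (2 : ℝ) ^ n ≤ Real.exp n := by
      have : (2 : ℝ) ≤ Real.exp 1 := by linarith [Real.add_one_le_exp (1 : ℝ)]
      calc (2 : ℝ) ^ n ≤ Real.exp 1 ^ n := pow_le_pow_left₀ (by norm_num) this _
        _ = _ := by rw [← Real.exp_nat_mul, mul_one]
    calc _ ≤ Real.exp n * Real.exp (-(1 / 10 * Real.exp (β * Real.log 2 * n))) :=
          mul_le_mul_of_nonneg_right c1 (Real.exp_pos _).le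
      _ ≤ η := by
          rw [← Real.exp_add, ← Real.le_log_iff_exp_le hη]
          linarith
  · rw [← Real.le_log_iff_exp_le hη]
    rw [div_le_iff₀ hδ] at a5
    linarith

set_option maxHeartbeats 2000000

theorem stmt3 (α : ℝ) (hα₁ : 1 / 2 < α) (hα₂ : α < 1) (γ : ℝ) (hγ : 0 < γ) :
    ∃ n₀ : ℕ, ∀ (n : ℕ) (ε : ℝ), n₀ ≤ n →
      (2 : ℝ) ^ (-((2 * α - 1) * (n : ℝ) / 2)) ≤ ε → ε ≤ 1 / 6 →
      ∀ m t : ℕ,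
        m = ⌈2 * (1 - α) * (n : ℝ) + (1 - α) * Real.sqrt n * Real.logb 2 n⌉₊ →
        t = n - m →
        1 - γ ≤ prD n t (1 / 2 + Real.logb 2 n / Real.sqrt n) (ε / Real.sqrt n)
          (FarFromJuntas n ⌊α * (n : ℝ)⌋₊ ε) := by
  set δ : ℝ := 1 - α with hδ
  have hδ0 : 0 < δ := by rw [hδ]; linarith
  set β : ℝ := (2 * α - 1) / 4 with hβ
  have hβ0 : 0 < β := by rw [hβ]; linarith
  set η : ℝ := min γ 1 / 3 with hη
  have hη0 : 0 < η := by rw [hη]; positivity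
  have hη1 : 3 * η ≤ 1 := by rw [hη]; linarith [min_le_right γ 1]
  have hηγ : 3 * η ≤ γ := by rw [hη]; linarith [min_le_left γ 1]
  obtain ⟨n₀, hn₀⟩ := Filter.eventually_atTop.1 (asymp δ β η hδ0 hβ0 hη0)
  refine ⟨n₀, ?_⟩
  intro n ε hn hε1 hε2 m t hm ht
  obtain ⟨hn1, e1, e2, e3, e4, e5, e6⟩ := hn₀ n hn
  set r : ℝ := Real.sqrt n with hr
  set L : ℝ := Real.logb 2 n with hL
  have hnR : (1 : ℝ) ≤ n := by exact_mod_cast hn1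
  have hr1 : 1 ≤ r := by rw [hr]; exact Real.one_le_sqrt.2 hnR
  have hr0 : 0 < r := by linarith
  have hrr : r * r = n := Real.mul_self_sqrt (by linarith)
  have hL0 : 0 ≤ L := Real.logb_nonneg (by norm_num) hnR
  have hε0 : 0 < ε := lt_of_lt_of_le (Real.rpow_pos_of_pos (by norm_num) _) hε1
  have hx0 : 0 ≤ 2 * δ * (n : ℝ) + δ * r * L := by positivity
  have hm1 : 2 * δ * (n : ℝ) + δ * r * L ≤ m := by rw [hm]; exact Nat.le_ceil _
  have hm2 : (m : ℝ) ≤ 2 * δ * (n : ℝ) + δ * r * L + 1 := by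
    rw [hm]; exact (Nat.ceil_lt_add_one hx0).le
  have hδβ : 2 * δ = 1 - 4 * β := by rw [hδ, hβ]; ring
  have hmβ : (m : ℝ) ≤ n - 3 * β * n := by
    rw [hδβ] at hm2; linarith
  have hmn : m ≤ n := by
    have : (m : ℝ) ≤ n := by nlinarith
    exact_mod_cast this
  have htn : t ≤ n := by omega
  have hntm : n - t = m := by omega
  have htR : (t : ℝ) = n - m := by rw [ht]; exact Nat.cast_sub hmn
  have hLr0 : 0 ≤ L / r := by positivity
  have hρ0 : 0 ≤ ε / r := by positivity
  have hρ1 : ε / r ≤ 1 := by rw [div_le_one hr0]; linarith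
  set b : ℝ := Real.exp (-(1 / 10 * (2 : ℝ) ^ (β * n))) with hb
  -- size of ε N
  have hN : (2 : ℝ) ^ (β * n) ≤ ε * 2 ^ t := by
    have h1 : (2 : ℝ) ^ (β * n) ≤ (2 : ℝ) ^ (-((2 * α - 1) * (n : ℝ) / 2)) * (2 : ℝ) ^ (t : ℝ) := by
      rw [← Real.rpow_add (by norm_num)]
      apply Real.rpow_le_rpow_of_exponent_le (by norm_num)
      have : (2 * α - 1) = 4 * β := by rw [hβ]; ring
      rw [this, htR]
      linarith
    rw [Real.rpow_natCast] at h1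
    exact h1.trans (mul_le_mul_of_nonneg_right hε1 (by positivity))
  have hN' : (2 : ℝ) ^ (β * n) ≤ 2 ^ t := by
    have : (0 : ℝ) < 2 ^ t := by positivity
    nlinarith
  have hpow : (2 : ℝ) ^ n = 2 ^ t * 2 ^ (n - t) := by
    rw [← pow_add]; congr 1; omega
  set s : ℝ := δ * r * L / 2 with hs
  have hP0 : (0 : ℝ) < (2 : ℝ) ^ (β * n) := Real.rpow_pos_of_pos (by norm_num) _
  have hb2 : (2 : ℝ) ^ n * b ≤ η := e5
  have hn18 : (n : ℝ) * (18 * 2 ^ (n - t) / 2 ^ n) ≤ η := by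
    have : (18 * 2 ^ (n - t) / 2 ^ n : ℝ) = 18 / 2 ^ t := by
      rw [hpow]
      field_simp
    rw [this]
    refine le_trans ?_ e4
    refine mul_le_mul_of_nonneg_left ?_ (by linarith)
    exact div_le_div_of_nonneg_left (by norm_num) hP0 hN'
  have hbound : ∀ u : ℕ, s ≤ (u : ℝ) →
      Real.exp ((2 * ε * 2 ^ n / 4 - 7 / 64 * (2 ^ n * (1 - (1 - ε / r) ^ u))) / 2 ^ (n - t)) ≤ b := by
    intro u hu
    have p1 : (1 - ε / r) ^ u ≤ Real.exp (-(ε * (δ * L / 2))) := by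
      calc _ ≤ (Real.exp (-(ε / r))) ^ u :=
            pow_le_pow_left₀ (by linarith) (Real.one_sub_le_exp_neg _) _
        _ = Real.exp (-(u * (ε / r))) := by rw [← Real.exp_nat_mul]; congr 1; ring
        _ ≤ _ := by
            apply Real.exp_le_exp.2
            have := mul_le_mul_of_nonneg_right hu hρ0
            have e : s * (ε / r) = ε * (δ * L / 2) := by rw [hs]; field_simp
            linarith
    have p2 : Real.exp (-(ε * (δ * L / 2))) ≤ 1 - 58 / 10 * ε := by
      have hcv := convexOn_exp.2 (Set.mem_univ (-(δ * L / 12))) (Set.mem_univ (0 : ℝ))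
        (show (0 : ℝ) ≤ 6 * ε by linarith) (show (0 : ℝ) ≤ 1 - 6 * ε by linarith) (by ring)
      simp only [smul_eq_mul, mul_zero, add_zero, Real.exp_zero, mul_one] at hcv
      have e : 6 * ε * -(δ * L / 12) = -(ε * (δ * L / 2)) := by ring
      rw [e] at hcv
      have e3m := mul_le_mul_of_nonneg_left e3 (show (0 : ℝ) ≤ 6 * ε by linarith)
      linarith
    have p3 : 58 / 10 * ε ≤ 1 - (1 - ε / r) ^ u := by linarith
    rw [hb]
    apply Real.exp_le_exp.2
    have hK : (0 : ℝ) < 2 ^ (n - t) := by positivity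
    rw [div_le_iff₀ hK, hpow]
    have hTK : (0 : ℝ) < 2 ^ t * 2 ^ (n - t) := by positivity
    have q1 := mul_le_mul_of_nonneg_left p3 hTK.le
    have q2 := mul_le_mul_of_nonneg_right hN hK.le
    have q3 : 0 < (2 : ℝ) ^ (β * n) * 2 ^ (n - t) := by positivity
    linarith
  have hmain := prD_ge htn (1 / 2 + L / r) (ε / r) (FarFromJuntas n ⌊α * (n : ℝ)⌋₊ ε)
    (α * n + s - t) (1 - 2 * η) (1 / r) (by linarith) (by linarith) hρ0 hρ1 (by positivity)
    (by linarith) (by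
      intro M A hM hMA hA
      have := prSH_ge (k := ⌊α * (n : ℝ)⌋₊) M A hMA s ε (ε / r) b hρ0 hρ1 (Real.exp_pos _).le hε2
        (by
          rw [hM]
          have : ((⌊α * (n : ℝ)⌋₊ : ℕ) : ℝ) ≤ α * n :=
            Nat.floor_le (mul_nonneg (by linarith) (by linarith))
          linarith) (by rw [hM]; exact hbound)
      rw [hM] at this
      linarith)
  have htail : Real.exp (1 / r * (α * n + s - t) -
      ((n - t : ℕ) : ℝ) * (1 / 2 + L / r) * (1 / r - (1 / r) ^ 2 / 2)) ≤ η := by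
    refine le_trans (Real.exp_le_exp.2 ?_) e6
    rw [hntm, htR]
    have hmLr : 2 * δ * r * L ≤ m * (L / r) := by
      have h1 : 2 * δ * n * (L / r) ≤ m * (L / r) := by
        refine mul_le_mul_of_nonneg_right ?_ hLr0
        have : 0 ≤ δ * r * L := by positivity
        linarith
      have h2 : 2 * δ * n * (L / r) = 2 * δ * r * L := by
        rw [← hrr]; field_simp
      linarith
    have hsq : (1 / r) ^ 2 = 1 / n := by rw [← hrr]; field_simp
    have hmρ : (m : ℝ) * (1 / 2 + L / r) * ((1 / r) ^ 2 / 2) ≤ 1 / 2 := by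
      rw [hsq]
      have h1 : (m : ℝ) * (1 / 2 + L / r) ≤ n * 1 := by
        apply mul_le_mul _ (by linarith) (by linarith) (by linarith)
        exact_mod_cast hmn
      have h2 : (m : ℝ) * (1 / 2 + L / r) * (1 / n / 2) ≤ (n * 1) * (1 / n / 2) :=
        mul_le_mul_of_nonneg_right h1 (by positivity)
      have h3 : ((n : ℝ) * 1) * (1 / n / 2) = 1 / 2 := by field_simp
      linarith
    have hdiff : α * n + s - (n - m) - m * (1 / 2 + L / r) ≤ 1 / 2 - δ * r * L := by
      have : α = 1 - δ := by rw [hδ]; ring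
      rw [this, hs]
      linarith
    have h4 : 1 / r * (α * n + s - (n - m) - m * (1 / 2 + L / r)) ≤ 1 / r * (1 / 2 - δ * r * L) :=
      mul_le_mul_of_nonneg_left hdiff (by positivity)
    have h5 : 1 / r * (1 / 2 - δ * r * L) = 1 / r / 2 - δ * L := by field_simp
    have h6 : 1 / r ≤ 1 := by rw [div_le_one hr0]; exact hr1
    linarith
  refine le_trans ?_ hmain
  have : (1 - 2 * η) * (1 - η) ≤ (1 - 2 * η) * (1 - Real.exp (1 / r * (α * n + s - t) -
      ((n - t : ℕ) : ℝ) * (1 / 2 + L / r) * (1 / r - (1 / r) ^ 2 / 2))) :=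
    mul_le_mul_of_nonneg_left (by linarith) (by linarith)
  nlinarith
end

section
/- For every γ > 0 there is n₀ ∈ ℕ such that for all n ≥ n₀, all reals ε with 2^{−n} ≤ ε ≤ 1/6, and all integers j ≥ 0 and c ≥ 1 with c·2^j ≤ 2s, where s = n^{3/2}/(ε·(log₂ n)³·(log₂(n/ε))²) and L = ⌈log₂(2s)⌉, the following holds: setting λ = 1 − (1 − ε/√n)^{2^j}, p = 1/2, and q = 1/2 + (log₂ n)/√n, the total variation distance between the Binomial(c, p·λ) distribution and the Binomial(c, q·λ) distribution is at most γ/L. -/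
/-- The probability mass function of the Binomial(c, r) distribution at `k`. -/
noncomputable def binomPMF (c : ℕ) (r : ℝ) (k : ℕ) : ℝ :=
  (c.choose k : ℝ) * r ^ k * (1 - r) ^ (c - k)

/-- Total variation distance between Binomial(c, r₁) and Binomial(c, r₂),
as distributions on `{0, 1, …, c}`. -/
noncomputable def tvBinom (c : ℕ) (r₁ r₂ : ℝ) : ℝ :=
  (1 / 2) * ∑ k ∈ Finset.range (c + 1), |binomPMF c r₁ k - binomPMF c r₂ k|

lemma binom_sum (c : ℕ) (r : ℝ) : ∑ k ∈ Finset.range (c + 1), binomPMF c r k = 1 := by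
  have h := add_pow r (1 - r) c
  rw [show r + (1 - r) = 1 by ring, one_pow] at h
  rw [h]
  refine Finset.sum_congr rfl fun k _ => ?_
  unfold binomPMF; ring

lemma binom_pos (c k : ℕ) (hk : k ∈ Finset.range (c + 1)) (a : ℝ) (h0 : 0 < a) (h1 : a < 1) :
    0 < binomPMF c a k := by
  unfold binomPMF
  have : 0 < c.choose k := Nat.choose_pos (by simp at hk; omega)
  have h2 : 0 < 1 - a := by linarith
  positivity

lemma binom_chi (c : ℕ) (a b : ℝ) (h0 : 0 < a) (h1 : a < 1) :
    ∑ k ∈ Finset.range (c + 1), (binomPMF c a k - binomPMF c b k) ^ 2 / binomPMF c a k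
      = (1 + (b - a) ^ 2 / (a * (1 - a))) ^ c - 1 := by
  have h2 : 0 < 1 - a := by linarith
  have e : 1 + (b - a) ^ 2 / (a * (1 - a)) = b ^ 2 / a + (1 - b) ^ 2 / (1 - a) := by
    field_simp; ring
  have h := add_pow (b ^ 2 / a) ((1 - b) ^ 2 / (1 - a)) c
  have key : ∑ k ∈ Finset.range (c + 1), (binomPMF c a k - binomPMF c b k) ^ 2 / binomPMF c a k
      = ∑ k ∈ Finset.range (c + 1), (binomPMF c a k - 2 * binomPMF c b k +
        (b ^ 2 / a) ^ k * ((1 - b) ^ 2 / (1 - a)) ^ (c - k) * (c.choose k : ℝ)) := by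
    refine Finset.sum_congr rfl fun k hk => ?_
    have hp := binom_pos c k hk a h0 h1
    have hb : binomPMF c b k ^ 2 = binomPMF c a k *
        ((b ^ 2 / a) ^ k * ((1 - b) ^ 2 / (1 - a)) ^ (c - k) * (c.choose k : ℝ)) := by
      unfold binomPMF
      rw [div_pow, div_pow, ← pow_mul, ← pow_mul]
      field_simp
      try ring
    rw [div_eq_iff hp.ne']
    linear_combination hb
  rw [key, e, h, Finset.sum_add_distrib, Finset.sum_sub_distrib, ← Finset.mul_sum,
    binom_sum, binom_sum]
  ring

lemma tv_sq (c : ℕ) (a b : ℝ) (h0 : 0 < a) (h1 : a < 1) :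
    tvBinom c a b ^ 2 ≤ (1 / 4) * ((1 + (b - a) ^ 2 / (a * (1 - a))) ^ c - 1) := by
  have h := Finset.sum_sq_le_sum_mul_sum_of_sq_le_mul (Finset.range (c + 1))
    (r := fun k => |binomPMF c a k - binomPMF c b k|)
    (f := fun k => (binomPMF c a k - binomPMF c b k) ^ 2 / binomPMF c a k)
    (g := fun k => binomPMF c a k)
    (fun k hk => by have := binom_pos c k hk a h0 h1; positivity)
    (fun k hk => (binom_pos c k hk a h0 h1).le)
    (fun k hk => by
      have := binom_pos c k hk a h0 h1
      simp only [sq_abs]; exact le_of_eq (by field_simp))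
  rw [binom_chi c a b h0 h1, binom_sum] at h
  unfold tvBinom
  rw [mul_pow]
  linarith

lemma logb_sq_le (y : ℝ) (hy : 1 ≤ y) : (Real.logb 2 y) ^ 2 ≤ 9 * y := by
  have hs : 0 < Real.sqrt y := Real.sqrt_pos.2 (by linarith)
  have h1 : Real.log y ≤ 2 * Real.sqrt y := by
    have := Real.log_le_sub_one_of_pos hs
    rw [Real.log_sqrt (by linarith)] at this
    linarith
  have h0 : 0 ≤ Real.log y := Real.log_nonneg hy
  have h2 : Real.log y ^ 2 ≤ 4 * y := by
    have := Real.sq_sqrt (show 0 ≤ y by linarith)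
    nlinarith
  have hl := Real.log_two_gt_d9
  unfold Real.logb
  rw [div_pow, div_le_iff₀ (by positivity)]
  have : (4 / 9 : ℝ) ≤ Real.log 2 ^ 2 := by nlinarith
  nlinarith

lemma ev_large (K : ℝ) : ∃ n₀ : ℕ, ∀ n : ℕ, n₀ ≤ n → K ≤ Real.logb 2 n ∧
    81 * (Real.logb 2 n) ^ 6 ≤ n := by
  have h1 : Filter.Tendsto (fun n : ℕ => Real.logb 2 (n : ℝ)) Filter.atTop Filter.atTop :=
    (Real.tendsto_logb_atTop (by norm_num)).comp tendsto_natCast_atTop_atTop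
  have h2 : ∀ᶠ x : ℝ in Filter.atTop, ‖Real.log x ^ 6‖ ≤ (1 / 5184) * ‖id x‖ :=
    (Real.isLittleO_pow_log_id_atTop (n := 6)).def (by norm_num)
  have h3 := tendsto_natCast_atTop_atTop (R := ℝ) |>.eventually h2
  obtain ⟨N, hN⟩ := Filter.eventually_atTop.1 ((h1.eventually_ge_atTop K).and h3)
  refine ⟨N, fun n hn => ⟨(hN n hn).1, ?_⟩⟩
  have h := (hN n hn).2
  simp only [id, Real.norm_eq_abs, Nat.abs_cast] at h
  have h := (le_abs_self _).trans h
  have hl := Real.log_two_gt_d9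
  unfold Real.logb
  rw [div_pow]
  have : (1 / 64 : ℝ) ≤ Real.log 2 ^ 6 := by
    calc (1 / 64 : ℝ) = (1 / 2) ^ 6 := by norm_num
      _ ≤ _ := by gcongr; linarith
  have h6 : 0 ≤ Real.log (n : ℝ) ^ 6 := by positivity
  have : Real.log (n : ℝ) ^ 6 / Real.log 2 ^ 6 ≤ Real.log (n : ℝ) ^ 6 / (1 / 64) := by gcongr
  linarith

set_option maxHeartbeats 2000000 in
theorem stmt14 (γ : ℝ) (hγ : 0 < γ) :
    ∃ n₀ : ℕ, ∀ (n : ℕ) (ε : ℝ) (j c : ℕ),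
      n₀ ≤ n → (2 : ℝ) ^ (-(n : ℝ)) ≤ ε → ε ≤ 1 / 6 → 1 ≤ c →
      ∀ s : ℝ,
        s = (n : ℝ) ^ ((3 : ℝ) / 2) /
              (ε * (Real.logb 2 n) ^ 3 * (Real.logb 2 ((n : ℝ) / ε)) ^ 2) →
        (c : ℝ) * 2 ^ j ≤ 2 * s →
        ∀ lam : ℝ, lam = 1 - (1 - ε / Real.sqrt n) ^ (2 ^ j) →
        tvBinom c ((1 / 2) * lam) ((1 / 2 + Real.logb 2 n / Real.sqrt n) * lam) ≤
          γ / (⌈Real.logb 2 (2 * s)⌉₊ : ℝ) := by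
  obtain ⟨n₀, hn₀⟩ := ev_large (max 8 (36 / γ ^ 2))
  refine ⟨n₀ + 1, fun n ε j c hn hε1 hε2 hc s hs hcs lam hlam => ?_⟩
  obtain ⟨hK, h81⟩ := hn₀ n (by omega)
  have hu8 := (le_max_left _ _).trans hK
  have huγ := (le_max_right _ _).trans hK
  have hε : 0 < ε := lt_of_lt_of_le (by positivity) hε1
  have hn1 : (1 : ℝ) ≤ n := by exact_mod_cast (show 1 ≤ n by omega)
  set u := Real.logb 2 (n : ℝ) with hu
  have hy : (n : ℝ) ≤ n / ε := by rw [le_div_iff₀ hε]; nlinarith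
  have hy1 : 1 ≤ (n : ℝ) / ε := hn1.trans hy
  have hw9 := logb_sq_le _ hy1
  have huw : u ≤ Real.logb 2 ((n : ℝ) / ε) :=
    Real.logb_le_logb_of_le (by norm_num) (by linarith) hy
  set w := Real.logb 2 ((n : ℝ) / ε) with hw
  have hu0 : 0 < u := by linarith
  have hw0 : 0 < w := by linarith
  set r := Real.sqrt (n : ℝ) with hr
  have hr2 : r ^ 2 = n := Real.sq_sqrt (by linarith)
  have hr1 : 1 ≤ r := Real.one_le_sqrt.2 hn1
  have hr0 : 0 < r := by linarith
  have hru : 9 * u ^ 3 ≤ r := Real.le_sqrt_of_sq_le (by nlinarith)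
  have hpow : (n : ℝ) ^ ((3 : ℝ) / 2) = n * r := by
    rw [show (3 : ℝ) / 2 = 1 + 1 / 2 by norm_num, Real.rpow_add (by linarith), Real.rpow_one,
      hr, Real.sqrt_eq_rpow]
  rw [hpow] at hs
  have hD : 0 < ε * u ^ 3 * w ^ 2 := by positivity
  have hs1 : 1 ≤ s := by
    rw [hs, le_div_iff₀ hD]
    have h9 : ε * w ^ 2 ≤ 9 * n := by
      calc ε * w ^ 2 ≤ ε * (9 * (n / ε)) := by gcongr
        _ = 9 * n := by field_simp
    calc 1 * (ε * u ^ 3 * w ^ 2) = (ε * w ^ 2) * u ^ 3 := by ring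
      _ ≤ 9 * n * u ^ 3 := by gcongr
      _ = n * (9 * u ^ 3) := by ring
      _ ≤ n * r := by gcongr
  -- the bound on L
  have hs2 : 2 * s ≤ (n / ε) ^ 2 := by
    have hrn : r ≤ n := by nlinarith
    have h1 : ε ≤ ε * u ^ 3 * w ^ 2 := by
      have a1 : 1 ≤ u ^ 3 := one_le_pow₀ (by linarith)
      have a2 : 1 ≤ w ^ 2 := one_le_pow₀ (by linarith)
      nlinarith [mul_le_mul a1 a2 (by norm_num) (by linarith)]
    have h2 : s ≤ n * n / ε := by
      rw [hs]; gcongr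
    calc 2 * s ≤ 2 * (n * n / ε) := by linarith
      _ = (n / ε) ^ 2 * (2 * ε) := by field_simp
      _ ≤ (n / ε) ^ 2 * 1 := by gcongr; linarith
      _ = _ := mul_one _
  have hL1 : 1 ≤ Real.logb 2 (2 * s) := by
    have := Real.logb_le_logb_of_le (b := 2) (by norm_num) (by norm_num) (show (2:ℝ) ≤ 2 * s by linarith)
    rwa [Real.logb_self_eq_one (by norm_num)] at this
  have hL2 : Real.logb 2 (2 * s) ≤ 2 * w := by
    have := Real.logb_le_logb_of_le (b := 2) (by norm_num) (by linarith) hs2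
    rw [Real.logb_pow] at this
    exact_mod_cast this
  set L : ℝ := (⌈Real.logb 2 (2 * s)⌉₊ : ℝ) with hL
  have hLpos : 1 ≤ L := hL1.trans (Nat.le_ceil _)
  have hL3 : L ≤ 3 * w := by
    have := Nat.ceil_lt_add_one (show 0 ≤ Real.logb 2 (2 * s) by linarith)
    rw [← hL] at this
    linarith
  -- lambda
  have ht0 : 0 < ε / r := by positivity
  have ht1 : ε / r < 1 := by rw [div_lt_one hr0]; linarith
  have hlam0 : 0 < lam := by
    have := pow_lt_one₀ (show 0 ≤ 1 - ε / r by linarith) (by linarith) (n := 2 ^ j) (by positivity)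
    linarith
  have hlam1 : lam ≤ 1 := by
    have : 0 ≤ (1 - ε / r) ^ (2 ^ j) := pow_nonneg (by linarith) _
    linarith
  have hlam2 : lam ≤ 2 ^ j * (ε / r) := by
    have := one_add_mul_le_pow (show -2 ≤ -(ε / r) by linarith) (2 ^ j)
    rw [← sub_eq_add_neg 1] at this
    push_cast at this
    linarith
  have htv := tv_sq c (1 / 2 * lam) ((1 / 2 + u / r) * lam) (by linarith) (by linarith)
  set x := (c : ℝ) * (4 * (u / r) ^ 2 * lam) with hx
  have hx0 : 0 ≤ x := by positivity
  have hxle : x ≤ 8 / (u * w ^ 2) := by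
    have : (c : ℝ) * lam ≤ 2 * s * (ε / r) := by
      calc (c : ℝ) * lam ≤ c * (2 ^ j * (ε / r)) := by gcongr
        _ = c * 2 ^ j * (ε / r) := by ring
        _ ≤ _ := by gcongr
    calc x = 4 * (u / r) ^ 2 * (c * lam) := by rw [hx]; ring
      _ ≤ 4 * (u / r) ^ 2 * (2 * s * (ε / r)) := by gcongr
      _ = 8 / (u * w ^ 2) := by
        rw [hs, ← hr2]; field_simp; norm_num
  have huw1 : 8 ≤ u * w ^ 2 := by
    have a2 : 1 ≤ w ^ 2 := one_le_pow₀ (by linarith)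
    calc (8 : ℝ) = 8 * 1 := by norm_num
      _ ≤ u * w ^ 2 := mul_le_mul hu8 a2 (by norm_num) hu0.le
  have hx1 : x ≤ 1 := hxle.trans (by rw [div_le_one (by positivity)]; exact huw1)
  have hexp : (1 + ((1 / 2 + u / r) * lam - 1 / 2 * lam) ^ 2 / (1 / 2 * lam * (1 - 1 / 2 * lam))) ^ c
      ≤ Real.exp x := by
    have hden : 0 < 1 - 1 / 2 * lam := by linarith
    have : ((1 / 2 + u / r) * lam - 1 / 2 * lam) ^ 2 / (1 / 2 * lam * (1 - 1 / 2 * lam))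
        ≤ 4 * (u / r) ^ 2 * lam := by
      rw [div_le_iff₀ (by positivity)]
      have : 0 ≤ (u / r) ^ 2 * lam ^ 2 := by positivity
      nlinarith only [this, mul_le_mul_of_nonneg_left hlam1 this]
    rw [hx, Real.exp_nat_mul]
    refine pow_le_pow_left₀ (by positivity) ?_ c
    have := Real.add_one_le_exp (4 * (u / r) ^ 2 * lam)
    linarith
  have hexp2 : Real.exp x - 1 ≤ 2 * x := by
    have := Real.abs_exp_sub_one_le (x := x) (by rwa [abs_of_nonneg hx0])
    rw [abs_of_nonneg hx0] at this
    exact (le_abs_self _).trans this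
  have htv2 : tvBinom c (1 / 2 * lam) ((1 / 2 + u / r) * lam) ^ 2 ≤ 4 / (u * w ^ 2) := by
    have : 4 / (u * w ^ 2) = (8 / (u * w ^ 2)) / 2 := by ring
    linarith
  refine abs_le_of_sq_le_sq' (htv2.trans ?_) (by positivity) |>.2
  have huγ' : 36 ≤ u * γ ^ 2 := by rwa [div_le_iff₀ (by positivity)] at huγ
  rw [div_pow, div_le_div_iff₀ (by positivity) (by positivity)]
  have : L ^ 2 ≤ (3 * w) ^ 2 := by gcongr
  linarith [mul_le_mul_of_nonneg_right huγ' (sq_nonneg w)]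
end
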